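/- arXiv:2005.03269 — 2 statements merged into one kernel-verified Lean document; each statement's English description precedes it below -/
import Mathlib

section
/- Let t_γ := 1 − R Σ_{i=1}^∞ λ_{i+1} ρ^{i−1}. If t < t_γ, then dim_H E_γ(t) > 0. -/
open MeasureTheory Filter Set Topology ENNReal

namespace HomogeneousCantorDensity

noncomputable def R (N : ℕ) (ρ : ℝ) : ℝ := (1 - ρ) / ((N : ℝ) - 1)

noncomputable def f (N : ℕ) (ρ : ℝ) (i : ℕ) (x : ℝ) : ℝ := ρ * x + (i : ℝ) * R N ρ

noncomputable def piMap (N : ℕ) (ρ : ℝ) (d : ℕ → ℕ) : ℝ :=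
  R N ρ * ∑' i : ℕ, (d i : ℝ) * ρ ^ i

def cantorE (N : ℕ) (ρ : ℝ) : Set ℝ :=
  {x | ∃ d : ℕ → ℕ, (∀ i, d i < N) ∧ x = piMap N ρ d}

/-- `μ = ∑_{i=0}^{N-1} (1/N) μ ∘ f_i⁻¹`. -/
def IsSelfSimilar (N : ℕ) (ρ : ℝ) (μ : Measure ℝ) : Prop :=
  μ = ∑ i ∈ Finset.range N, (N : ℝ≥0∞)⁻¹ • μ.map (f N ρ i)

/-- `T^n x` for `x = piMap N ρ d`. -/
noncomputable def Tn (N : ℕ) (ρ : ℝ) (d : ℕ → ℕ) (n : ℕ) : ℝ :=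
  piMap N ρ (fun i => d (n + i))

/-- pointwise lower `s`-density of `μ` at `x`. -/
noncomputable def lowerDensity (μ : Measure ℝ) (s x : ℝ) : ℝ :=
  liminf (fun r : ℝ => (μ (Ioo (x - r) (x + r))).toReal / (2 * r) ^ s) (𝓝[>] 0)

/-- pointwise upper `s`-density of `μ` at `x`. -/
noncomputable def upperDensity (μ : Measure ℝ) (s x : ℝ) : ℝ :=
  limsup (fun r : ℝ => (μ (Ioo (x - r) (x + r))).toReal / (2 * r) ^ s) (𝓝[>] 0)

/-- reflection of a sequence: `(c_i) ↦ (N-1-c_i)`. -/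
def reflSeq (N : ℕ) (a : ℕ → ℕ) : ℕ → ℕ := fun i => N - 1 - a i

/-- lexicographic order `a ≼ b` on sequences. -/
def lexLE (a b : ℕ → ℕ) : Prop :=
  a = b ∨ ∃ n : ℕ, (∀ i < n, a i = b i) ∧ a n < b n

/-- the shifted sequence `d_{n+1} d_{n+2} …` (0-indexed). -/
def shiftSeq (d : ℕ → ℕ) (n : ℕ) : ℕ → ℕ := fun i => d (n + i)

/-- `γ_{n+1}(x)` for `x = piMap N ρ d` (`d` 0-indexed, so `d n` is the digit `d_{n+1}`). -/
noncomputable def gam (N : ℕ) (ρ : ℝ) (d : ℕ → ℕ) (n : ℕ) : ℝ :=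
  if d n = 0 then Tn N ρ d (n + 1)
  else if d n = N - 1 then 1 - Tn N ρ d (n + 1)
  else max (Tn N ρ d (n + 1)) (1 - Tn N ρ d (n + 1))

/-- `E_γ(t) = {x ∈ E : liminf_n γ_n(x) ≥ t}`. -/
def Egamma (N : ℕ) (ρ : ℝ) (t : ℝ) : Set ℝ :=
  {x | ∃ d : ℕ → ℕ, (∀ i, d i < N) ∧ x = piMap N ρ d ∧
    t ≤ liminf (fun n => gam N ρ d n) atTop}

/-- the symbolic set `E'_γ(t)`, described via the coding `α` of the smallest element of `E`
that is `≥ t`. -/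
def Egamma' (N : ℕ) (α : ℕ → ℕ) : Set (ℕ → ℕ) :=
  {d | (∀ i, d i < N) ∧ ∀ n : ℕ,
    (d n = 0 → lexLE α (shiftSeq d (n + 1))) ∧
    (1 ≤ d n → d n ≤ N - 2 →
      lexLE α (shiftSeq d (n + 1)) ∨ lexLE (shiftSeq d (n + 1)) (reflSeq N α)) ∧
    (d n = N - 1 → lexLE (shiftSeq d (n + 1)) (reflSeq N α))}

/-- real value of a bit -/
noncomputable def bv (b : Bool) : ℝ := if b then 1 else 0

/-- power series of a binary sequence -/
noncomputable def V (ρ : ℝ) (y : ℕ → Bool) : ℝ := ∑' i : ℕ, bv (y i) * ρ ^ i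

/-- the Thue-Morse substitution on sequences -/
def th (z : ℕ → Bool) : ℕ → Bool := fun j => xor (z (j / 2)) (decide (j % 2 = 1))

/-- digit attached to a pair of bits -/
def dig (N : ℕ) (u w : Bool) : ℕ := (if w then 1 else 0) + (if u then 0 else N - 2)

/-- digit sequence attached to a binary sequence -/
def dseq (N : ℕ) (y : ℕ → Bool) : ℕ → ℕ := fun i => dig N (y i) (y (i + 1))

/-- shift -/
def sh (k : ℕ) (y : ℕ → Bool) : ℕ → Bool := fun i => y (k + i)

lemma bv_nonneg (b : Bool) : 0 ≤ bv b := by unfold bv; split_ifs <;> norm_num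
lemma bv_le_one (b : Bool) : bv b ≤ 1 := by unfold bv; split_ifs <;> norm_num
lemma bv_not (b : Bool) : bv (!b) = 1 - bv b := by cases b <;> simp [bv]

lemma hasSum_cg {u v : ℕ → ℝ} {a : ℝ} (h : HasSum u a) (e : ∀ i, u i = v i) :
    HasSum v a := by
  rwa [funext e] at h

lemma V_summable {ρ : ℝ} (h0 : 0 < ρ) (h1 : ρ < 1) (y : ℕ → Bool) :
    Summable (fun i => bv (y i) * ρ ^ i) := by
  refine Summable.of_nonneg_of_le (fun i => mul_nonneg (bv_nonneg _) (by positivity))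
    (fun i => ?_) (summable_geometric_of_lt_one h0.le h1)
  exact mul_le_of_le_one_left (by positivity) (bv_le_one _)

lemma V_nonneg {ρ : ℝ} (h0 : 0 < ρ) (y : ℕ → Bool) : 0 ≤ V ρ y :=
  tsum_nonneg (fun i => mul_nonneg (bv_nonneg _) (by positivity))

lemma V_le {ρ : ℝ} (h0 : 0 < ρ) (h1 : ρ < 1) (y : ℕ → Bool) : V ρ y ≤ (1 - ρ)⁻¹ := by
  rw [← tsum_geometric_of_lt_one h0.le h1]
  refine (V_summable h0 h1 y).tsum_le_tsum (fun i => ?_) (summable_geometric_of_lt_one h0.le h1)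
  exact mul_le_of_le_one_left (by positivity) (bv_le_one _)

lemma V_cons {ρ : ℝ} (h0 : 0 < ρ) (h1 : ρ < 1) (y : ℕ → Bool) :
    V ρ y = bv (y 0) + ρ * V ρ (fun i => y (i + 1)) := by
  unfold V
  rw [(V_summable h0 h1 y).tsum_eq_zero_add, ← tsum_mul_left]
  simp only [pow_zero, mul_one]
  congr 1
  exact tsum_congr (fun i => by ring)

lemma V_not {ρ : ℝ} (h0 : 0 < ρ) (h1 : ρ < 1) (y : ℕ → Bool) :
    V ρ (fun i => !(y i)) = (1 - ρ)⁻¹ - V ρ y := by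
  unfold V
  rw [← tsum_geometric_of_lt_one h0.le h1,
    ← (summable_geometric_of_lt_one h0.le h1).tsum_sub (V_summable h0 h1 y)]
  exact tsum_congr (fun i => by rw [bv_not]; ring)

lemma th_even (z : ℕ → Bool) (k : ℕ) : th z (2 * k) = z k := by
  simp [th]

lemma th_odd (z : ℕ → Bool) (k : ℕ) : th z (2 * k + 1) = !(z k) := by
  have h1 : (2 * k + 1) / 2 = k := by omega
  have h2 : (2 * k + 1) % 2 = 1 := by omega
  simp [th, h1, h2]

lemma V_th {ρ : ℝ} (h0 : 0 < ρ) (h1 : ρ < 1) (z : ℕ → Bool) :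
    V ρ (th z) = (1 - ρ) * V (ρ ^ 2) z + ρ * (1 - ρ ^ 2)⁻¹ := by
  have h2 : ρ ^ 2 < 1 := by nlinarith
  have h3 : 0 < ρ ^ 2 := by positivity
  have s := V_summable h3 h2 z
  have s' := V_summable h3 h2 (fun i => !(z i))
  have e1 : HasSum (fun k => bv (th z (2 * k)) * ρ ^ (2 * k)) (V (ρ ^ 2) z) := by
    have := s.hasSum
    simp only [th_even, pow_mul]
    exact this
  have e2 : HasSum (fun k => bv (th z (2 * k + 1)) * ρ ^ (2 * k + 1))
      (ρ * V (ρ ^ 2) (fun i => !(z i))) := by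
    have := s'.hasSum.mul_left ρ
    refine hasSum_cg this (fun k => ?_)
    rw [th_odd, ← pow_mul]; ring
  have e3 : V ρ (th z) = V (ρ ^ 2) z + ρ * V (ρ ^ 2) (fun i => !(z i)) :=
    (HasSum.even_add_odd (f := fun i => bv (th z i) * ρ ^ i) e1 e2).tsum_eq
  rw [e3, V_not h3 h2]; ring

lemma sh_th (z : ℕ → Bool) (k : ℕ) : sh (2 * k) (th z) = th (sh k z) := by
  funext i
  have h1 : (2 * k + i) / 2 = k + i / 2 := by omega
  have h2 : (2 * k + i) % 2 = i % 2 := by omega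
  simp [sh, th, h1, h2]

lemma th_not (z : ℕ → Bool) : th (fun i => !(z i)) = fun i => !(th z i) := by
  funext i; simp [th]

lemma thn_not (n : ℕ) (z : ℕ → Bool) : th^[n] (fun i => !(z i)) = fun i => !(th^[n] z i) := by
  induction n with
  | zero => rfl
  | succ n ih => rw [Function.iterate_succ_apply', ih, th_not, Function.iterate_succ_apply']

lemma thn_zero (n : ℕ) (z : ℕ → Bool) : th^[n] z 0 = z 0 := by
  induction n with
  | zero => rfl
  | succ n ih => rw [Function.iterate_succ_apply', ← ih]; simp [th]

/-- Thue-Morse -/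
def tm (n : ℕ) : Bool := if h : n = 0 then false else xor (tm (n / 2)) (decide (n % 2 = 1))
termination_by n
decreasing_by omega

lemma tm_zero : tm 0 = false := by unfold tm; simp

lemma th_tm : th tm = tm := by
  funext n
  rcases Nat.eq_zero_or_pos n with rfl | h
  · simp [th, tm_zero]
  · conv_rhs => unfold tm
    simp [th, h.ne']

lemma tm_even (k : ℕ) : tm (2 * k) = tm k := by
  conv_lhs => rw [← th_tm]
  exact th_even _ _
lemma tm_odd (k : ℕ) : tm (2 * k + 1) = !(tm k) := by
  conv_lhs => rw [← th_tm]
  exact th_odd _ _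
lemma tm_one : tm 1 = true := by simpa [tm_zero] using tm_odd 0
lemma tm_two : tm 2 = true := by simpa [tm_one] using tm_even 1
lemma tm_three : tm 3 = false := by simpa [tm_one] using tm_odd 1

lemma tm_pow (n : ℕ) : ∀ j < 2 ^ n, tm (2 ^ n + j) = !(tm j) := by
  induction n with
  | zero => intro j hj; have : j = 0 := by simpa using hj
            subst this; simp [tm_zero, tm_one]
  | succ n ih =>
    intro j hj
    rcases Nat.even_or_odd' j with ⟨k, rfl | rfl⟩
    · have : 2 ^ (n + 1) + 2 * k = 2 * (2 ^ n + k) := by ring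
      rw [this, tm_even, tm_even, ih k (by rw [pow_succ] at hj; omega)]
    · have : 2 ^ (n + 1) + (2 * k + 1) = 2 * (2 ^ n + k) + 1 := by ring
      rw [this, tm_odd, tm_odd, ih k (by rw [pow_succ] at hj; omega)]

lemma dig_not (N : ℕ) (hN : 2 ≤ N) (u w : Bool) : dig N (!u) (!w) = N - 1 - dig N u w := by
  cases u <;> cases w <;> simp [dig] <;> omega

lemma lam_pow (N : ℕ) (hN : 2 ≤ N) (lam : ℕ → ℕ) (hlam1 : lam 1 = N - 1)
    (hlam3 : ∀ n : ℕ, lam (2 ^ (n + 1)) = N - lam (2 ^ n)) (n : ℕ) :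
    lam (2 ^ n) = dig N (tm (2 ^ n - 1)) (tm (2 ^ n)) := by
  have hp : ∀ n, tm (2 ^ n) = true := fun n => by simpa [tm_zero] using tm_pow n 0 (by positivity)
  induction n with
  | zero => simp [tm_zero, tm_one, hlam1, dig]; omega
  | succ n ih =>
    have h : 2 ^ (n + 1) - 1 = 2 ^ n + (2 ^ n - 1) := by
      have := Nat.one_le_two_pow (n := n); rw [pow_succ]; omega
    rw [hlam3, ih, h, tm_pow n _ (by have := Nat.one_le_two_pow (n := n); omega), hp, hp]
    cases tm (2 ^ n - 1) <;> simp [dig] <;> omega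

lemma lam_eq (N : ℕ) (hN : 2 ≤ N) (lam : ℕ → ℕ) (hlam1 : lam 1 = N - 1)
    (hlam2 : ∀ n j : ℕ, 1 ≤ j → j < 2 ^ n → lam (2 ^ n + j) = N - 1 - lam j)
    (hlam3 : ∀ n : ℕ, lam (2 ^ (n + 1)) = N - lam (2 ^ n)) (i : ℕ) :
    lam (i + 1) = dig N (tm i) (tm (i + 1)) := by
  induction i using Nat.strong_induction_on with
  | _ i ih =>
    obtain ⟨n, hn1, hn2⟩ : ∃ n, 2 ^ n ≤ i + 1 ∧ i + 1 < 2 ^ (n + 1) :=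
      ⟨Nat.log 2 (i + 1), Nat.pow_log_le_self 2 (by omega), Nat.lt_pow_succ_log_self (by omega) _⟩
    obtain ⟨j, hj⟩ := Nat.exists_eq_add_of_le hn1
    rw [pow_succ] at hn2
    rcases Nat.eq_zero_or_pos j with rfl | hjp
    · have := lam_pow N hN lam hlam1 hlam3 n
      have h2 : 2 ^ n = i + 1 := by omega
      rw [h2] at this
      simpa using this
    · obtain ⟨j, rfl⟩ := Nat.exists_eq_add_of_le' hjp
      have hi : i = 2 ^ n + j := by omega
      have h1 := Nat.one_le_two_pow (n := n)
      rw [hj, hlam2 n (j + 1) (by omega) (by omega), ih j (by omega), hi,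
        tm_pow n j (by omega), tm_pow n (j + 1) (by omega), dig_not N hN]

lemma sh_succ (k : ℕ) (y : ℕ → Bool) : (fun i => sh k y (i + 1)) = sh (k + 1) y := by
  funext i; simp only [sh]; congr 1; omega

lemma V_sh {ρ : ℝ} (h0 : 0 < ρ) (h1 : ρ < 1) (k : ℕ) (y : ℕ → Bool) :
    V ρ (sh k y) = bv (y k) + ρ * V ρ (sh (k + 1) y) := by
  rw [V_cons h0 h1, sh_succ]; simp [sh]

lemma V_tm_ge {ρ : ℝ} (h0 : 0 < ρ) (h1 : ρ < 1) : ρ + ρ ^ 2 ≤ V ρ (sh 0 tm) := by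
  rw [V_sh h0 h1, V_sh h0 h1, V_sh h0 h1]
  have := V_nonneg h0 (sh (0 + 1 + 1 + 1) tm)
  simp only [zero_add, tm_zero, tm_one, tm_two, Nat.reduceAdd, bv] at *
  simp
  nlinarith [pow_pos h0 3, mul_nonneg (pow_pos h0 3).le this]

lemma sh_zero (y : ℕ → Bool) : sh 0 y = y := by funext i; simp [sh]

lemma key (n : ℕ) : ∀ (ρ : ℝ), 0 < ρ → ρ ≤ 1 / 4 → ∀ (z : ℕ → Bool) (k : ℕ),
    th^[n] z k = false → th^[n] z (k + 1) = true →
    V ρ (sh k (th^[n] z)) ≤ V ρ tm + ρ ^ (2 ^ n) * (1 - ρ)⁻¹ := by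
  induction n with
  | zero =>
    intro ρ h0 h4 z k hk hk1
    rw [V_sh h0 (by linarith), hk]
    have h := V_le h0 (by linarith) (sh (k + 1) (th^[0] z))
    have h' := V_nonneg h0 tm
    have h2 := mul_le_mul_of_nonneg_left h h0.le
    simp only [bv, pow_zero, pow_one]
    simp only [Bool.false_eq_true, if_false]
    linarith
  | succ n ih =>
    intro ρ h0 h4 z k hk hk1
    have h1 : ρ < 1 := by linarith
    have h2 : (0 : ℝ) < ρ ^ 2 := by positivity
    have h3 : ρ ^ 2 ≤ 1 / 4 := by nlinarith
    have h3' : ρ ^ 2 < 1 := by linarith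
    have herr : 0 ≤ ρ ^ (2 ^ (n + 1)) * (1 - ρ)⁻¹ := by
      have : 0 < 1 - ρ := by linarith
      positivity
    rw [Function.iterate_succ_apply'] at hk hk1 ⊢
    have htm := V_tm_ge h0 h1
    rw [sh_zero] at htm
    rcases Nat.even_or_odd' k with ⟨k, rfl | rfl⟩
    · rw [th_even] at hk
      rw [sh_th, V_th h0 h1, ← th_tm, V_th h0 h1]
      cases hb : th^[n] z (k + 1) with
      | true =>
        have := ih (ρ ^ 2) h2 h3 z k hk hb
        have e : (1 - ρ) * ((ρ ^ 2) ^ (2 ^ n) * (1 - ρ ^ 2)⁻¹) ≤ ρ ^ (2 ^ (n + 1)) * (1 - ρ)⁻¹ := by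
          rw [← pow_mul, ← pow_succ']
          have hp : 0 < ρ ^ (2 ^ (n + 1)) := by positivity
          have : (1 - ρ) * (1 - ρ ^ 2)⁻¹ ≤ (1 - ρ)⁻¹ := by
            rw [← div_eq_mul_inv, inv_eq_one_div, div_le_div_iff₀ (by linarith) (by linarith)]
            nlinarith
          nlinarith
        nlinarith
      | false =>
        have a1 := V_sh h2 h3' k (th^[n] z)
        rw [V_sh h2 h3' (k + 1), hk, hb] at a1
        have a2 := V_le h2 h3' (sh (k + 1 + 1) (th^[n] z))
        have a3 := V_tm_ge h2 h3'
        rw [sh_zero] at a3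
        have a4 : (1 - ρ ^ 2)⁻¹ ≤ 4 / 3 := by
          rw [inv_eq_one_div, div_le_div_iff₀ (by linarith) (by norm_num)]; linarith
        simp [bv] at a1
        have a5 : V (ρ ^ 2) (sh k (th^[n] z)) ≤ V (ρ ^ 2) tm := by
          rw [a1]
          nlinarith
        nlinarith
    · have e : 2 * k + 1 + 1 = 2 * (k + 1) := by ring
      rw [e, th_even] at hk1
      have b1 := V_sh h0 h1 (2 * k + 1) (th (th^[n] z))
      have e2 : 2 * k + 1 + 1 + 1 = 2 * (k + 1) + 1 := by ring
      rw [V_sh h0 h1 (2 * k + 1 + 1), V_sh h0 h1 (2 * k + 1 + 1 + 1), hk, e2, e, th_even, th_odd,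
        hk1] at b1
      simp [bv] at b1
      have b2 := V_le h0 h1 (sh (2 * (k + 1) + 1 + 1) (th (th^[n] z)))
      have a4 : (1 - ρ)⁻¹ ≤ 4 / 3 := by
        rw [inv_eq_one_div, div_le_div_iff₀ (by linarith) (by norm_num)]; linarith
      rw [b1]
      have : ρ ^ 2 * (ρ * V ρ (sh (2 * (k + 1) + 1 + 1) (th (th^[n] z)))) ≤ ρ ^ 2 * 1 := by
        refine mul_le_mul_of_nonneg_left ?_ h2.le
        nlinarith
      nlinarith

/-- combined bound, for `n + 1` substitutions -/
lemma key2 (n : ℕ) (ρ : ℝ) (h0 : 0 < ρ) (h4 : ρ ≤ 1 / 4) (z : ℕ → Bool) (k : ℕ)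
    (hk : th^[n + 1] z (k + 1) = true) :
    V ρ (sh (k + 1) (th^[n + 1] z)) ≤ V ρ (sh 1 tm) + ρ ^ (2 ^ (n + 1)) * (1 - ρ)⁻¹ / ρ := by
  have h1 : ρ < 1 := by linarith
  have e0 := V_sh h0 h1 0 tm
  rw [tm_zero, sh_zero] at e0
  simp [bv] at e0
  cases hb : th^[n + 1] z k with
  | false =>
    have := key (n + 1) ρ h0 h4 z k hb hk
    rw [V_sh h0 h1, hb, e0] at this
    simp only [bv, Bool.false_eq_true, if_false, zero_add] at this
    rw [← mul_le_mul_iff_right₀ h0, mul_add, mul_div_cancel₀ _ h0.ne']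
    exact this
  | true =>
    have htm := V_tm_ge h0 h1
    rw [sh_zero, e0] at htm
    have herr : 0 ≤ ρ ^ (2 ^ (n + 1)) * (1 - ρ)⁻¹ / ρ := by
      have : 0 < 1 - ρ := by linarith
      positivity
    rw [Function.iterate_succ_apply'] at hb hk ⊢
    rcases Nat.even_or_odd' k with ⟨k, rfl | rfl⟩
    · rw [th_odd] at hk
      rw [th_even] at hb
      simp [hb] at hk
    · have e : 2 * k + 1 + 1 = 2 * (k + 1) := by ring
      rw [V_sh h0 h1, V_sh h0 h1]
      rw [e, th_even] at hk
      rw [e, th_even, th_odd, hk]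
      have b2 := V_le h0 h1 (sh (2 * (k + 1) + 1 + 1) (th (th^[n] z)))
      have a4 : (1 - ρ)⁻¹ ≤ 4 / 3 := by
        rw [inv_eq_one_div, div_le_div_iff₀ (by linarith) (by norm_num)]; linarith
      simp [bv]
      have : ρ * (ρ * V ρ (sh (2 * (k + 1) + 1 + 1) (th (th^[n] z)))) ≤ ρ * 1 := by
        refine mul_le_mul_of_nonneg_left ?_ h0.le
        nlinarith
      nlinarith

lemma dig_cast (N : ℕ) (hN : 2 ≤ N) (u w : Bool) :
    (dig N u w : ℝ) = bv w + ((N : ℝ) - 2) * (1 - bv u) := by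
  cases u <;> cases w <;> simp [dig, bv, Nat.cast_sub hN]

lemma P_eq (N : ℕ) (hN : 2 ≤ N) {ρ : ℝ} (h0 : 0 < ρ) (h1 : ρ < 1) (y : ℕ → Bool) :
    piMap N ρ (dseq N y) = R N ρ * (V ρ (sh 1 y) + ((N : ℝ) - 2) * ((1 - ρ)⁻¹ - V ρ y)) := by
  unfold piMap
  congr 1
  have s1 := (V_summable h0 h1 (sh 1 y)).hasSum
  have s2 := (V_summable h0 h1 (fun i => !(y i))).hasSum.mul_left ((N : ℝ) - 2)
  rw [← V_not h0 h1]
  refine HasSum.tsum_eq (hasSum_cg (s1.add s2) (fun i => ?_))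
  rw [dseq, dig_cast N hN, bv_not]
  simp only [sh, add_comm 1 i]
  ring

lemma R_pos (N : ℕ) (hN : 2 ≤ N) {ρ : ℝ} (h1 : ρ < 1) : 0 < R N ρ := by
  have : (2 : ℝ) ≤ N := by exact_mod_cast hN
  unfold R
  exact div_pos (by linarith) (by linarith)

lemma P_not (N : ℕ) (hN : 2 ≤ N) {ρ : ℝ} (h0 : 0 < ρ) (h1 : ρ < 1) (y : ℕ → Bool) :
    piMap N ρ (dseq N (fun i => !(y i))) = 1 - piMap N ρ (dseq N y) := by
  have hs : sh 1 (fun i => !(y i)) = fun i => !(sh 1 y i) := rfl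
  rw [P_eq N hN h0 h1, P_eq N hN h0 h1, hs, V_not h0 h1, V_not h0 h1]
  have : (2 : ℝ) ≤ N := by exact_mod_cast hN
  have h2 : (N : ℝ) - 1 ≠ 0 := by linarith
  have h3 : 1 - ρ ≠ 0 := by linarith
  have : R N ρ * ((N : ℝ) - 1) * (1 - ρ)⁻¹ = 1 := by
    unfold R; field_simp
  linear_combination this

lemma P_nonneg (N : ℕ) (hN : 2 ≤ N) {ρ : ℝ} (h0 : 0 < ρ) (h1 : ρ < 1) (y : ℕ → Bool) :
    0 ≤ piMap N ρ (dseq N y) :=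
  mul_nonneg (R_pos N hN h1).le (tsum_nonneg (fun i => by positivity))

lemma P_le_one (N : ℕ) (hN : 2 ≤ N) {ρ : ℝ} (h0 : 0 < ρ) (h1 : ρ < 1) (y : ℕ → Bool) :
    piMap N ρ (dseq N y) ≤ 1 := by
  have := P_nonneg N hN h0 h1 (fun i => !(y i))
  rw [P_not N hN h0 h1] at this
  linarith

lemma coef (N : ℕ) (hN : 2 ≤ N) (ρ : ℝ) (h0 : 0 < ρ) (hρ1 : ρ ≤ 1 / (N : ℝ) ^ 2) :
    0 < 1 - ((N : ℝ) - 2) * ρ ∧ ρ ≤ 1 / 4 := by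
  have h2 : (2 : ℝ) ≤ N := by exact_mod_cast hN
  rw [le_div_iff₀ (by positivity)] at hρ1
  have h4 : (4 : ℝ) ≤ (N : ℝ) ^ 2 := by nlinarith
  have h5 := mul_le_mul_of_nonneg_left h4 h0.le
  constructor <;> nlinarith

lemma P_mono (N : ℕ) (hN : 2 ≤ N) (ρ : ℝ) (h0 : 0 < ρ) (hρ1 : ρ ≤ 1 / (N : ℝ) ^ 2)
    (y y' : ℕ → Bool) (hy : y 0 = y' 0) (e : ℝ) (he : 0 ≤ e) (h : V ρ y ≤ V ρ y' + e) :
    piMap N ρ (dseq N y) ≤ piMap N ρ (dseq N y') + R N ρ * (e / ρ) := by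
  obtain ⟨hc, h4⟩ := coef N hN ρ h0 hρ1
  have h1 : ρ < 1 := by linarith
  have h2 : (2 : ℝ) ≤ N := by exact_mod_cast hN
  rw [P_eq N hN h0 h1, P_eq N hN h0 h1, ← mul_add]
  refine mul_le_mul_of_nonneg_left ?_ (R_pos N hN h1).le
  have a := V_sh h0 h1 0 y
  have b := V_sh h0 h1 0 y'
  rw [sh_zero, zero_add] at a b
  rw [a, b, hy] at h
  rw [a, b, hy]
  set W := V ρ (sh 1 y)
  set W' := V ρ (sh 1 y')
  have hW : W - W' ≤ e / ρ := by
    rw [le_div_iff₀ h0]; linarith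
  have h5 : (1 - ((N : ℝ) - 2) * ρ) * (W - W') ≤ e / ρ := by
    refine (mul_le_mul_of_nonneg_left hW hc.le).trans ?_
    refine mul_le_of_le_one_left (by positivity) ?_
    have : 0 ≤ ((N : ℝ) - 2) * ρ := mul_nonneg (by linarith) h0.le
    linarith
  linarith

lemma Tn_eq (N : ℕ) (ρ : ℝ) (y : ℕ → Bool) (n : ℕ) :
    Tn N ρ (dseq N y) n = piMap N ρ (dseq N (sh n y)) := rfl

lemma gam_ge (N : ℕ) (hN : 2 ≤ N) (ρ : ℝ) (y : ℕ → Bool) (n : ℕ) (t : ℝ)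
    (ht1 : y (n + 1) = true → t ≤ 1 - Tn N ρ (dseq N y) (n + 1))
    (ht0 : y (n + 1) = false → t ≤ Tn N ρ (dseq N y) (n + 1)) :
    t ≤ gam N ρ (dseq N y) n := by
  have hd : dseq N y n = dig N (y n) (y (n + 1)) := rfl
  unfold gam
  rw [hd]
  cases hu : y n <;> cases hw : y (n + 1)
  · have := ht0 hw
    split_ifs with c1 c2
    · exact this
    · simp [dig] at c2 c1; omega
    · exact this.trans (le_max_left _ _)
  · have := ht1 hw
    have c1 : ¬ dig N false true = 0 := by simp [dig]
    have c2 : dig N false true = N - 1 := by simp [dig]; omega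
    rw [if_neg c1, if_pos c2]; exact this
  · have := ht0 hw
    rw [if_pos (by simp [dig])]; exact this
  · have := ht1 hw
    rw [if_neg (by simp [dig])]
    split_ifs
    · exact this
    · exact this.trans (le_max_right _ _)

lemma gam_le (N : ℕ) (hN : 2 ≤ N) {ρ : ℝ} (h0 : 0 < ρ) (h1 : ρ < 1) (y : ℕ → Bool) (n : ℕ) :
    gam N ρ (dseq N y) n ≤ 1 := by
  have a := P_nonneg N hN h0 h1 (sh (n + 1) y)
  have b := P_le_one N hN h0 h1 (sh (n + 1) y)
  rw [← Tn_eq] at a b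
  unfold gam
  split_ifs
  · exact b
  · linarith
  · exact max_le b (by linarith)

lemma mem_Egamma (N : ℕ) (hN : 2 ≤ N) (ρ : ℝ) (h0 : 0 < ρ) (hρ1 : ρ ≤ 1 / (N : ℝ) ^ 2)
    (t : ℝ) (n : ℕ)
    (hn : t + R N ρ * (ρ ^ (2 ^ (n + 1)) * (1 - ρ)⁻¹ / ρ / ρ) ≤ 1 - piMap N ρ (dseq N (sh 1 tm)))
    (z : ℕ → Bool) : piMap N ρ (dseq N (th^[n + 1] z)) ∈ Egamma N ρ t := by
  obtain ⟨hc, h4⟩ := coef N hN ρ h0 hρ1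
  have h1 : ρ < 1 := by linarith
  have herr : 0 ≤ ρ ^ (2 ^ (n + 1)) * (1 - ρ)⁻¹ / ρ := by
    have : 0 < 1 - ρ := by linarith
    positivity
  have main : ∀ (z : ℕ → Bool) (k : ℕ), th^[n + 1] z (k + 1) = true →
      t ≤ 1 - piMap N ρ (dseq N (sh (k + 1) (th^[n + 1] z))) := by
    intro z k hk
    have := P_mono N hN ρ h0 hρ1 (sh (k + 1) (th^[n + 1] z)) (sh 1 tm)
      (by simp only [sh, add_zero, tm_one]; exact hk) _ herr (key2 n ρ h0 h4 z k hk)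
    linarith
  refine ⟨_, fun i => ?_, rfl, ?_⟩
  · unfold dseq dig
    split_ifs <;> omega
  · refine le_liminf_of_le ?_ (Eventually.of_forall fun k => ?_)
    · exact IsBoundedUnder.isCoboundedUnder_ge
        ⟨1, eventually_map.mpr (Eventually.of_forall fun k => gam_le N hN h0 h1 _ k)⟩
    · refine gam_ge N hN ρ _ k t (fun hk => main z k hk) (fun hk => ?_)
      have h := main (fun i => !(z i)) k (by rw [thn_not]; simp only [hk]; rfl)
      rw [thn_not] at h
      have e : sh (k + 1) (fun i => !(th^[n + 1] z i)) = fun i => !(sh (k + 1) (th^[n + 1] z) i) :=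
        rfl
      rw [e, P_not N hN h0 h1] at h
      rw [Tn_eq]; linarith

lemma V_thn (n : ℕ) : ∀ (ρ : ℝ), 0 < ρ → ρ < 1 → ∃ a b : ℝ, 0 < b ∧
    ∀ z, V ρ (th^[n] z) = a + b * V (ρ ^ (2 ^ n)) z := by
  induction n with
  | zero => intro ρ h0 h1; exact ⟨0, 1, one_pos, fun z => by simp⟩
  | succ n ih =>
    intro ρ h0 h1
    obtain ⟨a, b, hb, h⟩ := ih (ρ ^ 2) (by positivity) (by nlinarith)
    refine ⟨(1 - ρ) * a + ρ * (1 - ρ ^ 2)⁻¹, (1 - ρ) * b, mul_pos (by linarith) hb, fun z => ?_⟩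
    rw [Function.iterate_succ_apply', V_th h0 h1, h, ← pow_mul, ← pow_succ']
    ring

/-- prepend a zero -/
def consF (z : ℕ → Bool) : ℕ → Bool := fun i => if i = 0 then false else z (i - 1)

lemma V_consF {q : ℝ} (h0 : 0 < q) (h1 : q < 1) (z : ℕ → Bool) : V q (consF z) = q * V q z := by
  rw [V_cons h0 h1]; simp [consF, bv]

lemma P_affine (N : ℕ) (hN : 2 ≤ N) (ρ : ℝ) (h0 : 0 < ρ) (hρ1 : ρ ≤ 1 / (N : ℝ) ^ 2) (n : ℕ) :
    ∃ a b : ℝ, 0 < b ∧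
      ∀ z, piMap N ρ (dseq N (th^[n] (consF z))) = a + b * V (ρ ^ (2 ^ n)) z := by
  obtain ⟨hc, h4⟩ := coef N hN ρ h0 hρ1
  have h1 : ρ < 1 := by linarith
  obtain ⟨a, b, hb, h⟩ := V_thn n ρ h0 h1
  have hR := R_pos N hN h1
  have hq0 : 0 < ρ ^ (2 ^ n) := by positivity
  have hq1 : ρ ^ (2 ^ n) < 1 := pow_lt_one₀ h0.le h1 (by positivity)
  refine ⟨R N ρ * (a / ρ + ((N : ℝ) - 2) * ((1 - ρ)⁻¹ - a)),
    R N ρ * ((1 - ((N : ℝ) - 2) * ρ) * (b * ρ ^ (2 ^ n) / ρ)), by positivity, fun z => ?_⟩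
  have e := V_sh h0 h1 0 (th^[n] (consF z))
  rw [sh_zero, thn_zero, h, V_consF hq0 hq1] at e
  have e0 : bv (consF z 0) = 0 := by simp [consF, bv]
  rw [e0, zero_add, zero_add] at e
  have e' : V ρ (sh 1 (th^[n] (consF z))) = (a + b * (ρ ^ (2 ^ n) * V (ρ ^ (2 ^ n)) z)) / ρ := by
    rw [e]; field_simp
  rw [P_eq N hN h0 h1, e', h, V_consF hq0 hq1]
  field_simp
  ring

lemma V_gap {q : ℝ} (h0 : 0 < q) (h1 : q ≤ 1 / 4) (m : ℕ) : ∀ z z' : ℕ → Bool,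
    (∀ i < m, z i = z' i) → z m ≠ z' m → q ^ m / 2 ≤ |V q z - V q z'| := by
  have h1' : q < 1 := by linarith
  induction m with
  | zero =>
    intro z z' _ hne
    rw [V_cons h0 h1' z, V_cons h0 h1' z']
    have a := V_nonneg h0 (fun i => z (i + 1))
    have b := V_nonneg h0 (fun i => z' (i + 1))
    have c := V_le h0 h1' (fun i => z (i + 1))
    have d := V_le h0 h1' (fun i => z' (i + 1))
    have a4 : (1 - q)⁻¹ ≤ 4 / 3 := by
      rw [inv_eq_one_div, div_le_div_iff₀ (by linarith) (by norm_num)]; linarith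
    cases hz : z 0 <;> cases hz' : z' 0
    · simp [hz, hz'] at hne
    · rw [le_abs]; right; simp [bv]; nlinarith
    · rw [le_abs]; left; simp [bv]; nlinarith
    · simp [hz, hz'] at hne
  | succ m ih =>
    intro z z' hz hne
    have := ih (fun i => z (i + 1)) (fun i => z' (i + 1)) (fun i hi => hz _ (by omega)) hne
    rw [V_cons h0 h1' z, V_cons h0 h1' z', hz 0 (by omega), add_sub_add_left_eq_sub, ← mul_sub,
      abs_mul, abs_of_pos h0, pow_succ]
    nlinarith

/-- bits as elements of `Fin 2` -/
def bf (z : ℕ → Bool) : ℕ → Fin 2 := fun i => if z i then 1 else 0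

lemma dimH_cantor (q : ℝ) (h0 : 0 < q) (h4 : q ≤ 1 / 4) : 0 < dimH (range (V q)) := by
  classical
  have hlog : Real.log q < 0 := Real.log_neg h0 (by linarith)
  set r : ℝ := Real.log 2 / (-Real.log q) with hr
  have hrpos : 0 < r := div_pos (Real.log_pos (by norm_num)) (by linarith)
  have hqr : q ^ r = 1 / 2 := by
    rw [Real.rpow_def_of_pos h0, hr]
    have : Real.log q * (Real.log 2 / -Real.log q) = - Real.log 2 := by
      field_simp [hlog.ne]
    rw [this, Real.exp_neg, Real.exp_log (by norm_num)]; norm_num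
  have hold : ∀ z z' : ℕ → Bool, |Real.ofDigits (bf z) - Real.ofDigits (bf z')| ≤
      2 ^ r * |V q z - V q z'| ^ r := by
    intro z z'
    by_cases hzz : z = z'
    · subst hzz; simp; positivity
    · have hex : ∃ m, z m ≠ z' m := Function.ne_iff.mp hzz
      have hm := Nat.find_spec hex
      have hlt : ∀ i < Nat.find hex, z i = z' i := fun i hi => by
        simpa using Nat.find_min hex hi
      set m := Nat.find hex
      have g := V_gap h0 h4 m z z' hlt hm
      have k := Real.abs_ofDigits_sub_ofDigits_le (x := bf z) (y := bf z') (n := m)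
        (fun i hi => by simp [bf, hlt i hi])
      refine k.trans ?_
      rw [← Real.mul_rpow (by norm_num) (abs_nonneg _)]
      have : ((2 : ℕ) ^ m : ℝ)⁻¹ = (q ^ m) ^ r := by
        rw [← Real.rpow_natCast, ← Real.rpow_natCast, ← Real.rpow_mul h0.le, mul_comm,
          Real.rpow_mul h0.le, hqr, one_div, Real.inv_rpow (by norm_num)]
        norm_num
      rw [this]
      exact Real.rpow_le_rpow (by positivity) (by linarith) hrpos.le
  choose g hg using fun x : range (V q) => x.2
  let F : ℝ → ℝ := fun x => if h : x ∈ range (V q) then Real.ofDigits (bf (g ⟨x, h⟩)) else 0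
  have hF : HolderOnWith (Real.toNNReal (2 ^ r)) (Real.toNNReal r) F (range (V q)) := by
    intro x hx y hy
    simp only [F, dif_pos hx, dif_pos hy]
    have := hold (g ⟨x, hx⟩) (g ⟨y, hy⟩)
    rw [hg, hg] at this
    rw [edist_dist, edist_dist, Real.dist_eq, Real.dist_eq, Real.coe_toNNReal _ hrpos.le,
      ENNReal.ofReal_rpow_of_nonneg (abs_nonneg _) hrpos.le]
    change _ ≤ ENNReal.ofReal (2 ^ r) * _
    rw [← ENNReal.ofReal_mul (by positivity)]
    exact ENNReal.ofReal_le_ofReal this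
  have hinj : ∀ z z', V q z = V q z' → z = z' := by
    intro z z' h
    by_contra hzz
    have hex : ∃ m, z m ≠ z' m := Function.ne_iff.mp hzz
    have hlt : ∀ i < Nat.find hex, z i = z' i := fun i hi => by
      simpa using Nat.find_min hex hi
    have g := V_gap h0 h4 _ z z' hlt (Nat.find_spec hex)
    rw [h, sub_self, abs_zero] at g
    have := pow_pos h0 (Nat.find hex)
    linarith
  have hsurj : Icc (0 : ℝ) 1 ⊆ F '' range (V q) := by
    intro x hx
    obtain ⟨d, -, hd⟩ := Real.ofDigits_SurjOn (b := 2) (by norm_num) hx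
    let z : ℕ → Bool := fun i => decide (d i = 1)
    refine ⟨V q z, ⟨z, rfl⟩, ?_⟩
    simp only [F, dif_pos (mem_range_self z)]
    have h1 : g ⟨V q z, mem_range_self z⟩ = z := hinj _ _ (hg _)
    have h2 : bf z = d := by
      funext i
      simp only [bf, z, decide_eq_true_eq]
      split_ifs with h
      · exact h.symm
      · omega
    rw [h1, h2, hd]
  have hI : dimH (Icc (0 : ℝ) 1) = 1 := by
    rw [Real.dimH_of_nonempty_interior (by rw [interior_Icc]; exact ⟨1 / 2, by norm_num⟩)]
    simp
  have hle := hF.dimH_image_le (by simpa using hrpos)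
  have := (dimH_mono hsurj).trans hle
  rw [hI] at this
  by_contra hcon
  have h00 : dimH (range (V q)) = 0 := by simpa using hcon
  rw [h00] at this
  simp at this

/-- Lemma 3.4: if `t < t_γ := 1 - R Σ_{i≥1} λ_{i+1} ρ^{i-1}`, then `dim_H E_γ(t) > 0`. -/
theorem dimH_Egamma_pos (N : ℕ) (hN : 2 ≤ N) (ρ : ℝ) (hρ0 : 0 < ρ)
    (hρ1 : ρ ≤ 1 / (N : ℝ) ^ 2)
    (lam : ℕ → ℕ) (hlam1 : lam 1 = N - 1)
    (hlam2 : ∀ n j : ℕ, 1 ≤ j → j < 2 ^ n → lam (2 ^ n + j) = N - 1 - lam j)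
    (hlam3 : ∀ n : ℕ, lam (2 ^ (n + 1)) = N - lam (2 ^ n))
    (t : ℝ) (ht : t < 1 - R N ρ * ∑' i : ℕ, (lam (i + 2) : ℝ) * ρ ^ i) :
    0 < dimH (Egamma N ρ t) := by
  obtain ⟨hc, h4⟩ := coef N hN ρ hρ0 hρ1
  have h1 : ρ < 1 := by linarith
  have hlam : R N ρ * ∑' i : ℕ, (lam (i + 2) : ℝ) * ρ ^ i = piMap N ρ (dseq N (sh 1 tm)) := by
    unfold piMap
    congr 1
    refine tsum_congr fun i => ?_
    have : lam (i + 2) = dseq N (sh 1 tm) i := by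
      rw [lam_eq N hN lam hlam1 hlam2 hlam3 (i + 1)]
      simp only [dseq, sh]
      congr 2 <;> omega
    rw [this]
  rw [hlam] at ht
  obtain ⟨n, hn⟩ : ∃ n : ℕ, t + R N ρ * (ρ ^ (2 ^ (n + 1)) * (1 - ρ)⁻¹ / ρ / ρ) ≤
      1 - piMap N ρ (dseq N (sh 1 tm)) := by
    have hR := R_pos N hN h1
    have h1' : 0 < 1 - ρ := by linarith
    set C := R N ρ * ((1 - ρ)⁻¹ / ρ / ρ) with hC
    have hCpos : 0 < C := by positivity
    obtain ⟨m, hm⟩ := exists_pow_lt_of_lt_one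
      (div_pos (sub_pos.mpr ht) hCpos) h1
    refine ⟨m, ?_⟩
    rw [lt_div_iff₀ hCpos] at hm
    have hle : ρ ^ (2 ^ (m + 1)) ≤ ρ ^ m :=
      pow_le_pow_of_le_one hρ0.le h1.le (by have := (Nat.lt_two_pow_self (n := m + 1)); omega)
    have e : R N ρ * (ρ ^ (2 ^ (m + 1)) * (1 - ρ)⁻¹ / ρ / ρ) = ρ ^ (2 ^ (m + 1)) * C := by
      rw [hC]; ring
    have := mul_le_mul_of_nonneg_right hle hCpos.le
    rw [e]; linarith
  obtain ⟨a, b, hb, hab⟩ := P_affine N hN ρ hρ0 hρ1 (n + 1)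
  set q := ρ ^ (2 ^ (n + 1)) with hq
  have hq0 : 0 < q := by positivity
  have hq4 : q ≤ 1 / 4 := (pow_le_of_le_one hρ0.le h1.le (by positivity)).trans h4
  have hpos := dimH_cantor q hq0 hq4
  refine hpos.trans_le ?_
  have hlip : LipschitzWith (Real.toNNReal (1 / b)) (fun x : ℝ => (x - a) / b) := by
    refine LipschitzWith.of_dist_le_mul fun x y => ?_
    rw [Real.dist_eq, Real.dist_eq, Real.coe_toNNReal _ (by positivity)]
    have : (x - a) / b - (y - a) / b = 1 / b * (x - y) := by ring
    rw [this, abs_mul, abs_of_pos (by positivity)]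
  refine le_trans (dimH_mono ?_) (hlip.dimH_image_le (Egamma N ρ t))
  rintro _ ⟨z, rfl⟩
  refine ⟨_, mem_Egamma N hN ρ hρ0 hρ1 t n hn (consF z), ?_⟩
  simp only
  rw [hab z]
  field_simp
  ring

end HomogeneousCantorDensity
end

section
/- Let t_η := R Σ_{i=1}^∞ θ_i ρ^{i−1}. If t < t_η, then dim_H E_η(t) > 0; and if t > t_η, then the set E_η(t) is at most countable. -/
open MeasureTheory Filter Set Topology ENNReal

namespace HomogeneousCantorDensity

/-- `E_η(t) = {x ∈ E : liminf_n max{T^n x, 1 - T^n x} ≥ t}`. -/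
def Eeta (N : ℕ) (ρ : ℝ) (t : ℝ) : Set ℝ :=
  {x | ∃ d : ℕ → ℕ, (∀ i, d i < N) ∧ x = piMap N ρ d ∧
    t ≤ liminf (fun n => max (Tn N ρ d n) (1 - Tn N ρ d n)) atTop}

/-! ### Combinatorics of binary sequences -/

/-- `d` is strictly larger than `u`, with first difference before `m`. -/
def Gt (u : ℕ → Bool) (m : ℕ) (d : ℕ → Bool) : Prop :=
  ∃ j < m, (∀ i < j, d i = u i) ∧ d j = true ∧ u j = false

/-- every shift of `d` or its reflection is strictly larger than `u`. -/
def Good (u : ℕ → Bool) (m : ℕ) (d : ℕ → Bool) : Prop :=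
  ∀ n, Gt u m (fun i => d (n + i)) ∨ Gt u m (fun i => !d (n + i))

/-- Thue-Morse recursion. -/
def IsTM (u : ℕ → Bool) : Prop :=
  u 0 = true ∧ (∀ i, u (2 * i) = u i) ∧ (∀ i, u (2 * i + 1) = !u i)

/-- the substitution `1 ↦ 10`, `0 ↦ 01`. -/
def phi (e : ℕ → Bool) (n : ℕ) : Bool := if n % 2 = 0 then e (n / 2) else !e (n / 2)

lemma phi_even (e : ℕ → Bool) (i : ℕ) : phi e (2 * i) = e i := by
  simp [phi]

lemma phi_odd (e : ℕ → Bool) (i : ℕ) : phi e (2 * i + 1) = !e i := by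
  have h1 : (2 * i + 1) % 2 = 1 := by omega
  have h2 : (2 * i + 1) / 2 = i := by omega
  simp [phi, h1, h2]

/-- eventually periodic. -/
def EP {α : Type*} (d : ℕ → α) : Prop := ∃ n p, 0 < p ∧ ∀ i, n ≤ i → d (i + p) = d i

lemma EP.of_shift {α : Type*} {d : ℕ → α} {k : ℕ} (h : EP (fun i => d (k + i))) : EP d := by
  obtain ⟨n, p, hp, h⟩ := h
  refine ⟨k + n, p, hp, fun i hi => ?_⟩
  have := h (i - k) (by omega)
  simp only at this
  rwa [show k + (i - k + p) = i + p by omega, show k + (i - k) = i by omega] at this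

lemma EP.comp {α β : Type*} {d : ℕ → α} (g : α → β) (h : EP d) : EP (fun i => g (d i)) := by
  obtain ⟨n, p, hp, h⟩ := h
  exact ⟨n, p, hp, fun i hi => by simp only [h i hi]⟩

lemma EP.phi {e : ℕ → Bool} (h : EP e) : EP (phi e) := by
  obtain ⟨n, p, hp, h⟩ := h
  refine ⟨2 * n, 2 * p, by omega, fun i hi => ?_⟩
  have h1 : (i + 2 * p) % 2 = i % 2 := by omega
  have h2 : (i + 2 * p) / 2 = i / 2 + p := by omega
  simp only [HomogeneousCantorDensity.phi, h1, h2, h (i / 2) (by omega)]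

lemma Good.reflect {u : ℕ → Bool} {m : ℕ} {d : ℕ → Bool} (h : Good u m d) :
    Good u m (fun i => !d i) := by
  intro n
  have := h n
  simp only [Bool.not_not]
  exact this.symm

lemma Good.shift {u : ℕ → Bool} {m : ℕ} {d : ℕ → Bool} (h : Good u m d) (k : ℕ) :
    Good u m (fun i => d (k + i)) := by
  intro n
  have := h (k + n)
  simpa only [add_assoc] using this

lemma IsTM.vals {u : ℕ → Bool} (hu : IsTM u) : u 0 = true ∧ u 1 = false ∧ u 2 = false ∧
    u 3 = true ∧ u 4 = false ∧ u 5 = true ∧ u 6 = true := by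
  obtain ⟨h0, he, ho⟩ := hu
  have h1 := ho 0
  have h2 := he 1
  have h3 := ho 1
  have h4 := he 2
  have h5 := ho 2
  have h6 := he 3
  simp_all

lemma Gt.window {u : ℕ → Bool} (hu : IsTM u) {m : ℕ} {d : ℕ → Bool} (h : Gt u m d) :
    d 0 = true ∧ (d 1 = true ∨ d 2 = true ∨ (d 3 = true ∧ (d 4 = true ∨
      (d 5 = true ∧ d 6 = true)))) := by
  obtain ⟨h0, h1, h2, h3, h4, h5, h6⟩ := hu.vals
  obtain ⟨j, -, hj, hd, huj⟩ := h
  rcases j with _ | _ | _ | _ | _ | _ | _ | j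
  · simp_all
  · have := hj 0 (by omega); simp_all
  · have := hj 0 (by omega); simp_all
  · simp_all
  · have := hj 0 (by omega); have := hj 3 (by omega); simp_all
  · simp_all
  · simp_all
  · have := hj 0 (by omega); have := hj 3 (by omega); have := hj 5 (by omega)
    have := hj 6 (by omega); simp_all

/-- Boolean form of the window condition. -/
def win (a b c d e f g : Bool) : Bool := a && (b || (c || (d && (e || (f && g)))))

lemma Good.window {u : ℕ → Bool} (hu : IsTM u) {m : ℕ} {d : ℕ → Bool} (h : Good u m d) (n : ℕ) :
    (win (d n) (d (n+1)) (d (n+2)) (d (n+3)) (d (n+4)) (d (n+5)) (d (n+6)) ||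
    win (!d n) (!d (n+1)) (!d (n+2)) (!d (n+3)) (!d (n+4)) (!d (n+5)) (!d (n+6))) = true := by
  rw [Bool.or_eq_true]
  rcases h n with h | h
  · left
    have := h.window hu
    simpa [win] using this
  · right
    have := h.window hu
    simpa [win] using this

/-- Boolean state used in the synchronization argument. -/
def stt (a b c d e f : Bool) : Bool :=
  (d == !c) && (f == !e) && ((c == d.not && e == !c) || (b == !a && c == !a && e == c))

lemma step_bool : ∀ a b c d e f g h i j k l : Bool, 
    (win b c d e f g h || win (!b) (!c) (!d) (!e) (!f) (!g) (!h)) = true →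
    (win a b c d e f g || win (!a) (!b) (!c) (!d) (!e) (!f) (!g)) = true →
    (win c d e f g h i || win (!c) (!d) (!e) (!f) (!g) (!h) (!i)) = true →
    (win d e f g h i j || win (!d) (!e) (!f) (!g) (!h) (!i) (!j)) = true →
    (win e f g h i j k || win (!e) (!f) (!g) (!h) (!i) (!j) (!k)) = true →
    (win f g h i j k l || win (!f) (!g) (!h) (!i) (!j) (!k) (!l)) = true →
    stt a b c d e f = true → stt c d e f g h = true := by
  decide

lemma Good.sync {u : ℕ → Bool} (hu : IsTM u) {m : ℕ} {d : ℕ → Bool} (h : Good u m d)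
    (h0 : d 0 = false) (h1 : d 1 = true) (h2 : d 2 = true) :
    ∀ i, d (2 * i + 1) = !d (2 * i) := by
  have hw := h.window hu
  have base : (d 3 = false) ∧ stt (d 0) (d 1) (d 2) (d 3) (d 4) (d 5) = true := by
    have w0 := hw 0
    have w1 := hw 1
    have w2 := hw 2
    have w3 := hw 3
    have w4 := hw 4
    simp only [Nat.zero_add, Nat.reduceAdd] at w0 w1 w2 w3 w4
    rw [h0, h1, h2] at *
    generalize d 3 = x3 at *
    generalize d 4 = x4 at *
    generalize d 5 = x5 at *
    generalize d 6 = x6 at *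
    generalize d 7 = x7 at *
    generalize d 8 = x8 at *
    generalize d 9 = x9 at *
    generalize d 10 = x10 at *
    clear hw h0 h1 h2 h
    revert x3 x4 x5 x6 x7 x8 x9 x10
    decide
  have key : ∀ i, stt (d (2*i)) (d (2*i+1)) (d (2*i+2)) (d (2*i+3)) (d (2*i+4)) (d (2*i+5))
      = true := by
    intro i
    induction i with
    | zero => simpa using base.2
    | succ i ih =>
      exact step_bool _ _ _ _ _ _ _ _ (d (2*i+8)) (d (2*i+9)) (d (2*i+10)) (d (2*i+11))
        (hw (2*i+1)) (hw (2*i)) (hw (2*i+2)) (hw (2*i+3)) (hw (2*i+4)) (hw (2*i+5)) ih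
  intro i
  rcases i with _ | i
  · simp [h0, h1]
  · have := key i
    simp only [stt, Bool.and_eq_true] at this
    rw [show 2 * (i + 1) = 2 * i + 2 by ring]
    simpa using this.1.1

lemma Gt.desub {u : ℕ → Bool} (hu : IsTM u) {m : ℕ} {e : ℕ → Bool} (h : Gt u m (phi e)) :
    Gt u ((m + 1) / 2) e := by
  obtain ⟨-, he, ho⟩ := hu
  obtain ⟨j, hjm, hj, hd, huj⟩ := h
  obtain ⟨i, rfl | rfl⟩ : ∃ i, j = 2 * i ∨ j = 2 * i + 1 := ⟨j / 2, by omega⟩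
  · refine ⟨i, by omega, fun l hl => ?_, ?_, ?_⟩
    · have := hj (2 * l) (by omega)
      rwa [phi_even, he] at this
    · rwa [phi_even] at hd
    · rwa [he] at huj
  · have := hj (2 * i) (by omega)
    rw [phi_even, he] at this
    rw [phi_odd] at hd
    rw [ho] at huj
    simp_all

lemma phi_shift (e : ℕ → Bool) (n : ℕ) :
    (fun i => phi e (2 * n + i)) = phi (fun i => e (n + i)) := by
  funext i
  have h1 : (2 * n + i) % 2 = i % 2 := by omega
  have h2 : (2 * n + i) / 2 = n + i / 2 := by omega
  simp only [phi, h1, h2]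

lemma phi_not (e : ℕ → Bool) : (fun i => !phi e i) = phi (fun i => !e i) := by
  funext i
  simp only [phi]
  split <;> simp

lemma Good.desub {u : ℕ → Bool} (hu : IsTM u) {m : ℕ} {e : ℕ → Bool} (h : Good u m (phi e)) :
    Good u ((m + 1) / 2) e := by
  intro n
  have h2 : (fun i => !phi e (2 * n + i)) = phi (fun i => !e (n + i)) := by
    rw [← phi_not, ← phi_shift]
  have h1 := h (2 * n)
  rw [h2, phi_shift] at h1
  exact h1.imp (fun h => h.desub hu) (fun h => h.desub hu)

lemma Good.ep {u : ℕ → Bool} (hu : IsTM u) (m : ℕ) : ∀ d : ℕ → Bool, Good u m d → EP d := by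
  induction m using Nat.strong_induction_on with
  | _ m ih =>
  intro d hd
  have hu0 := hu.1
  by_cases hm : m < 2
  · exfalso
    rcases hd 0 with ⟨j, hj, -, -, h⟩ | ⟨j, hj, -, -, h⟩ <;>
    · obtain rfl : j = 0 := by omega
      simp_all
  have main : ∀ d : ℕ → Bool, Good u m d → d 0 = false → d 1 = true → d 2 = true → EP d := by
    intro d hd h0 h1 h2
    have hs := hd.sync hu h0 h1 h2
    have : d = phi (fun i => d (2 * i)) := by
      funext n
      obtain ⟨i, rfl | rfl⟩ : ∃ i, n = 2 * i ∨ n = 2 * i + 1 := ⟨n / 2, by omega⟩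
      · rw [phi_even]
      · rw [phi_odd, hs]
    rw [this] at hd ⊢
    exact (ih _ (by omega) _ (hd.desub hu)).phi
  by_cases H : ∃ n, d n ≠ d (n + 1) ∧ d (n + 1) = d (n + 2)
  · obtain ⟨n, hn1, hn2⟩ := H
    apply EP.of_shift (k := n)
    cases h0 : d n
    · apply main _ (hd.shift n) (by simpa using h0) <;> simp_all
    · have := main _ (hd.shift n).reflect (by simpa using h0) (by simp_all) (by simp_all)
      have := this.comp (fun b => !b)
      simpa using this
  · push Not at H
    by_cases hc : ∃ n, d n ≠ d (n + 1)
    · obtain ⟨n, hn⟩ := hc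
      have : ∀ k, d (n + k) ≠ d (n + k + 1) := by
        intro k
        induction k with
        | zero => simpa using hn
        | succ k ih => exact H _ ih
      refine ⟨n, 2, by omega, fun i hi => ?_⟩
      have h1 := this (i - n)
      have h2 := this (i - n + 1)
      rw [show n + (i - n) = i by omega] at h1
      rw [show n + (i - n + 1) = i + 1 by omega] at h2
      revert h1 h2
      rw [show i + 1 + 1 = i + 2 by omega]
      cases d i <;> cases d (i + 1) <;> cases d (i + 2) <;> simp
    · push Not at hc
      exact ⟨0, 1, by omega, fun i _ => (hc i).symm⟩

lemma countable_EP : {d : ℕ → ℕ | EP d}.Countable := by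
  have : {d : ℕ → ℕ | EP d} ⊆ ⋃ n : ℕ, ⋃ p : ℕ,
      {d | 0 < p ∧ ∀ i, n ≤ i → d (i + p) = d i} := by
    rintro d ⟨n, p, h⟩
    simp only [Set.mem_iUnion]
    exact ⟨n, p, h⟩
  refine Set.Countable.mono this (Set.countable_iUnion fun n => Set.countable_iUnion fun p => ?_)
  refine Set.countable_of_injective_of_countable_image
    (f := fun (d : ℕ → ℕ) (i : Fin (n + p)) => d i) ?_ (Set.to_countable _)
  rintro d ⟨hp, hd⟩ e ⟨-, he⟩ hde
  funext i
  induction i using Nat.strong_induction_on with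
  | _ i ih =>
  by_cases hi : i < n + p
  · exact congrFun hde ⟨i, hi⟩
  · have h1 := hd (i - p) (by omega)
    have h2 := he (i - p) (by omega)
    rw [show i - p + p = i by omega] at h1 h2
    rw [h1, h2]
    exact ih _ (by omega)

/-! weak condition and iterated substitution -/

/-- weak comparison on the first `m` digits. -/
def Ge (u : ℕ → Bool) (m : ℕ) (d : ℕ → Bool) : Prop :=
  (∃ j, (∀ i < j, d i = u i) ∧ d j = true ∧ u j = false) ∨ ∀ i < m, d i = u i

lemma Ge.phi {u : ℕ → Bool} (hu : IsTM u) {m : ℕ} {e : ℕ → Bool} (h : Ge u m e) :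
    Ge u (2 * m) (phi e) := by
  obtain ⟨-, he, ho⟩ := hu
  have key : ∀ m, (∀ i < m, e i = u i) → ∀ i < 2 * m, HomogeneousCantorDensity.phi e i = u i := by
    intro m h l hl
    obtain ⟨i, rfl | rfl⟩ : ∃ i, l = 2 * i ∨ l = 2 * i + 1 := ⟨l / 2, by omega⟩
    · rw [phi_even, he, h i (by omega)]
    · rw [phi_odd, ho, h i (by omega)]
  rcases h with ⟨j, h1, h2, h3⟩ | h
  · left
    exact ⟨2 * j, key j h1, by rwa [phi_even], by rwa [he]⟩
  · right
    exact key m h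

/-- weak admissibility. -/
def Wk (u : ℕ → Bool) (m : ℕ) (d : ℕ → Bool) : Prop :=
  ∀ n, Ge u m (fun i => d (n + i)) ∨ Ge u m (fun i => !d (n + i))

lemma Ge.odd {u : ℕ → Bool} (hu : IsTM u) {m : ℕ} {w : ℕ → Bool} (h0 : w 0 = true)
    (h12 : w 1 = true ∨ w 2 = true) : Ge u m w := by
  obtain ⟨u0, u1, u2, -⟩ := hu.vals
  left
  by_cases h1 : w 1 = true
  · refine ⟨1, fun i hi => ?_, h1, u1⟩
    obtain rfl : i = 0 := by omega
    rw [h0, u0]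
  · refine ⟨2, fun i hi => ?_, by tauto, u2⟩
    obtain rfl | rfl : i = 0 ∨ i = 1 := by omega
    · rw [h0, u0]
    · rw [u1]; simpa using h1

lemma Wk.phi {u : ℕ → Bool} (hu : IsTM u) {m : ℕ} {e : ℕ → Bool} (h : Wk u m e) :
    Wk u (2 * m) (phi e) := by
  intro n
  obtain ⟨k, rfl | rfl⟩ : ∃ i, n = 2 * i ∨ n = 2 * i + 1 := ⟨n / 2, by omega⟩
  · have h2 : (fun i => !HomogeneousCantorDensity.phi e (2 * k + i))
        = HomogeneousCantorDensity.phi (fun i => !e (k + i)) := by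
      rw [← phi_not, ← phi_shift]
    rw [h2, phi_shift]
    exact (h k).imp (fun h => h.phi hu) (fun h => h.phi hu)
  · have e0 := phi_odd e k
    have e1 := phi_even e (k + 1)
    have e2 := phi_odd e (k + 1)
    rw [show 2 * (k + 1) = 2 * k + 1 + 1 by ring] at e1 e2
    cases hk : e k
    · left
      apply Ge.odd hu
      · simp [e0, hk]
      · simp only [e1]
        rw [show 2 * k + 1 + 2 = 2 * k + 1 + 1 + 1 by ring, e2]
        cases e (k + 1) <;> simp
    · right
      apply Ge.odd hu
      · simp [e0, hk]
      · simp only [e1]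
        rw [show 2 * k + 1 + 2 = 2 * k + 1 + 1 + 1 by ring, e2]
        cases e (k + 1) <;> simp

lemma Wk.one {u : ℕ → Bool} (hu : IsTM u) (e : ℕ → Bool) : Wk u 1 e := by
  intro n
  cases h : e n
  · right; right
    intro i hi
    obtain rfl : i = 0 := by omega
    simp [h, hu.1]
  · left; right
    intro i hi
    obtain rfl : i = 0 := by omega
    simp [h, hu.1]

lemma wk_iter {u : ℕ → Bool} (hu : IsTM u) (k : ℕ) (e : ℕ → Bool) :
    Wk u (2 ^ k) (phi^[k] e) := by
  induction k with
  | zero => simpa using Wk.one hu e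
  | succ k ih =>
    rw [Function.iterate_succ_apply', pow_succ']
    exact ih.phi hu

lemma phi_iter_mul (k : ℕ) (e : ℕ → Bool) (i : ℕ) : phi^[k] e (2 ^ k * i) = e i := by
  induction k with
  | zero => simp
  | succ k ih =>
    rw [Function.iterate_succ_apply', pow_succ', mul_assoc, phi_even, ih]

lemma phi_iter_agree (k : ℕ) (e e' : ℕ → Bool) (m : ℕ) (h : ∀ i < m, e i = e' i) :
    ∀ i < 2 ^ k * m, phi^[k] e i = phi^[k] e' i := by
  induction k with
  | zero => simpa using h
  | succ k ih =>
    intro i hi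
    rw [pow_succ', mul_assoc] at hi
    rw [Function.iterate_succ_apply', Function.iterate_succ_apply']
    simp only [phi, ih (i / 2) (by omega)]

lemma isTM_of (u : ℕ → Bool) (h0 : u 0 = true)
    (h : ∀ n j, j < 2 ^ n → u (2 ^ n + j) = !u j) : IsTM u := by
  have key : ∀ i, u (2 * i) = u i ∧ u (2 * i + 1) = !u i := by
    intro i
    induction i using Nat.strong_induction_on with
    | _ i ih =>
    by_cases hi : i = 0
    · subst hi
      have := h 0 0 (by simp)
      simp_all
    · obtain ⟨n, h1, h2⟩ : ∃ n, 2 ^ n ≤ i ∧ i < 2 ^ (n + 1) :=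
        ⟨Nat.log 2 i, Nat.pow_log_le_self 2 hi, Nat.lt_pow_succ_log_self (by norm_num) i⟩
      obtain ⟨j, rfl⟩ := Nat.exists_eq_add_of_le h1
      rw [pow_succ'] at h2
      have hpos : 0 < 2 ^ n := by positivity
      obtain ⟨i1, i2⟩ := ih j (by omega)
      have e0 := h n j (by omega)
      have e1 := h (n + 1) (2 * j) (by rw [pow_succ']; omega)
      have e2 := h (n + 1) (2 * j + 1) (by rw [pow_succ']; omega)
      rw [show 2 * (2 ^ n + j) = 2 ^ (n + 1) + 2 * j by ring,
        show 2 ^ (n + 1) + 2 * j + 1 = 2 ^ (n + 1) + (2 * j + 1) by ring, e1, e2, e0, i1, i2]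
      simp
  exact ⟨h0, fun i => (key i).1, fun i => (key i).2⟩

/-! ### The coding map -/

lemma rho_lt_one {N : ℕ} (hN : 2 ≤ N) {ρ : ℝ} (hρ1 : ρ ≤ 1 / (N : ℝ) ^ 2) : ρ < 1 := by
  have hN' : (2 : ℝ) ≤ N := by exact_mod_cast hN
  have : 1 / (N : ℝ) ^ 2 ≤ 1 / 4 := by
    apply one_div_le_one_div_of_le <;> nlinarith
  linarith

lemma rho_lt_R {N : ℕ} (hN : 2 ≤ N) {ρ : ℝ} (hρ1 : ρ ≤ 1 / (N : ℝ) ^ 2) : ρ < R N ρ := by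
  have hN' : (2 : ℝ) ≤ N := by exact_mod_cast hN
  have h : ρ * (N : ℝ) ^ 2 ≤ 1 := by
    rwa [le_div_iff₀ (by positivity)] at hρ1
  rw [R, lt_div_iff₀ (by linarith)]
  have : ρ * N < 1 := by
    by_cases h0 : ρ ≤ 0
    · nlinarith
    · push Not at h0
      nlinarith [mul_pos h0 (by linarith : (0 : ℝ) < N)]
  nlinarith

section coding

variable {N : ℕ} {ρ : ℝ}

lemma pi_summable (hρ0 : 0 < ρ) (hρ : ρ < 1) {a : ℕ → ℕ} (ha : ∀ i, a i < N) :
    Summable (fun i => (a i : ℝ) * ρ ^ i) := by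
  refine Summable.of_nonneg_of_le (fun i => by positivity) (fun i => ?_)
    ((summable_geometric_of_lt_one hρ0.le hρ).mul_left (N : ℝ))
  have : (a i : ℝ) ≤ N := by exact_mod_cast (ha i).le
  gcongr

lemma pi_reflect (hN : 2 ≤ N) (hρ0 : 0 < ρ) (hρ : ρ < 1) {a : ℕ → ℕ} (ha : ∀ i, a i < N) :
    1 - piMap N ρ a = piMap N ρ (fun i => N - 1 - a i) := by
  have hN' : (2 : ℝ) ≤ N := by exact_mod_cast hN
  have s1 := pi_summable hρ0 hρ ha
  have s2 := pi_summable (N := N) hρ0 hρ (a := fun i => N - 1 - a i)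
    (fun i => by have := ha i; omega)
  have h1 : (∑' i, (a i : ℝ) * ρ ^ i) + ∑' i, ((N - 1 - a i : ℕ) : ℝ) * ρ ^ i
      = ((N : ℝ) - 1) * (1 - ρ)⁻¹ := by
    rw [← s1.tsum_add s2, ← tsum_geometric_of_lt_one hρ0.le hρ, ← tsum_mul_left]
    congr 1
    funext i
    have := ha i
    rw [Nat.cast_sub (by omega), Nat.cast_sub (by omega)]
    push_cast
    ring
  have h2 : R N ρ * (((N : ℝ) - 1) * (1 - ρ)⁻¹) = 1 := by
    rw [R]
    have : (N : ℝ) - 1 ≠ 0 := by linarith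
    have : 1 - ρ ≠ 0 := by linarith
    field_simp
  rw [← h1] at h2
  simp only [piMap]
  linarith

lemma R_nonneg (hN : 2 ≤ N) (hρ : ρ < 1) : 0 ≤ R N ρ := by
  have hN' : (2 : ℝ) ≤ N := by exact_mod_cast hN
  rw [R]
  apply div_nonneg <;> linarith

lemma pi_nonneg (hN : 2 ≤ N) (hρ0 : 0 < ρ) (hρ : ρ < 1) (a : ℕ → ℕ) : 0 ≤ piMap N ρ a :=
  mul_nonneg (R_nonneg hN hρ) (tsum_nonneg fun i => by positivity)

lemma pi_le_one (hN : 2 ≤ N) (hρ0 : 0 < ρ) (hρ : ρ < 1) {a : ℕ → ℕ} (ha : ∀ i, a i < N) :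
    piMap N ρ a ≤ 1 := by
  have := pi_reflect hN hρ0 hρ ha
  have := pi_nonneg hN hρ0 hρ (fun i => N - 1 - a i)
  linarith

lemma pi_split (hρ0 : 0 < ρ) (hρ : ρ < 1) {a : ℕ → ℕ} (ha : ∀ i, a i < N) (m : ℕ) :
    piMap N ρ a = R N ρ * ∑ i ∈ Finset.range m, (a i : ℝ) * ρ ^ i
      + ρ ^ m * piMap N ρ (fun i => a (m + i)) := by
  have s1 := pi_summable hρ0 hρ ha
  simp only [piMap]
  have h : ∑' i, (a (i + m) : ℝ) * ρ ^ (i + m) = ρ ^ m * ∑' i, (a (m + i) : ℝ) * ρ ^ i := by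
    rw [← tsum_mul_left]
    congr 1
    funext i
    rw [add_comm i m]
    ring
  rw [← s1.sum_add_tsum_nat_add m, h]
  ring

lemma pi_sub (hρ0 : 0 < ρ) (hρ : ρ < 1) {a b : ℕ → ℕ} (ha : ∀ i, a i < N) (hb : ∀ i, b i < N)
    (m : ℕ) (h : ∀ i < m, a i = b i) :
    piMap N ρ a - piMap N ρ b
      = ρ ^ m * (piMap N ρ (fun i => a (m + i)) - piMap N ρ (fun i => b (m + i))) := by
  rw [pi_split hρ0 hρ ha m, pi_split hρ0 hρ hb m]
  have : ∑ i ∈ Finset.range m, (a i : ℝ) * ρ ^ i = ∑ i ∈ Finset.range m, (b i : ℝ) * ρ ^ i :=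
    Finset.sum_congr rfl fun i hi => by rw [h i (Finset.mem_range.1 hi)]
  rw [this]
  ring

lemma pi_agree (hN : 2 ≤ N) (hρ0 : 0 < ρ) (hρ : ρ < 1) {a b : ℕ → ℕ} (ha : ∀ i, a i < N)
    (hb : ∀ i, b i < N) (m : ℕ) (h : ∀ i < m, a i = b i) :
    piMap N ρ a - piMap N ρ b ≤ ρ ^ m := by
  rw [pi_sub hρ0 hρ ha hb m h]
  have h1 := pi_le_one hN hρ0 hρ (a := fun i => a (m + i)) (fun i => ha _)
  have h2 := pi_nonneg hN hρ0 hρ (fun i => b (m + i))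
  exact mul_le_of_le_one_right (by positivity) (by linarith)

lemma pi_gap (hN : 2 ≤ N) (hρ0 : 0 < ρ) (hρ : ρ < 1) {a b : ℕ → ℕ} (ha : ∀ i, a i < N)
    (hb : ∀ i, b i < N) (j : ℕ) (h : ∀ i < j, a i = b i) (hj : b j < a j) :
    (R N ρ - ρ) * ρ ^ j ≤ piMap N ρ a - piMap N ρ b := by
  rw [pi_sub hρ0 hρ ha hb j h, mul_comm]
  apply mul_le_mul_of_nonneg_left _ (by positivity)
  rw [pi_split hρ0 hρ (a := fun i => a (j + i)) (fun i => ha _) 1,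
    pi_split hρ0 hρ (a := fun i => b (j + i)) (fun i => hb _) 1]
  have h1 := pi_nonneg hN hρ0 hρ (fun i => a (j + (1 + i)))
  have h2 := pi_le_one hN hρ0 hρ (a := fun i => b (j + (1 + i))) (fun i => hb _)
  have h3 : (b j : ℝ) + 1 ≤ a j := by exact_mod_cast hj
  have h4 := R_nonneg hN hρ
  simp only [Finset.range_one, Finset.sum_singleton, add_zero, pow_zero, mul_one, pow_one]
  nlinarith

end coding

/-- digits `0, N-1` from a binary sequence. -/
def val (N : ℕ) (b : Bool) : ℕ := if b then N - 1 else 0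

lemma val_lt {N : ℕ} (hN : 2 ≤ N) (b : Bool) : val N b < N := by
  cases b <;> simp [val] <;> omega

lemma val_not {N : ℕ} (b : Bool) : N - 1 - val N b = val N (!b) := by
  cases b <;> simp [val]

lemma Ge.pi {N : ℕ} (hN : 2 ≤ N) {ρ : ℝ} (hρ0 : 0 < ρ) (hρ1 : ρ ≤ 1 / (N : ℝ) ^ 2)
    {u d : ℕ → Bool} {m : ℕ} (h : Ge u m d) :
    piMap N ρ (fun i => val N (u i)) - ρ ^ m ≤ piMap N ρ (fun i => val N (d i)) := by
  have hρ := rho_lt_one hN hρ1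
  have hR := rho_lt_R hN hρ1
  have hp : 0 < ρ ^ m := by positivity
  rcases h with ⟨j, h1, h2, h3⟩ | h
  · have := pi_gap hN hρ0 hρ (a := fun i => val N (d i)) (b := fun i => val N (u i))
      (fun i => val_lt hN _) (fun i => val_lt hN _) j (fun i hi => by simp only [h1 i hi])
      (by simp only [h2, h3, val]; simp; omega)
    have h' : 0 ≤ (R N ρ - ρ) * ρ ^ j := mul_nonneg (by linarith) (by positivity)
    linarith
  · have := pi_agree hN hρ0 hρ (b := fun i => val N (d i)) (a := fun i => val N (u i))
      (fun i => val_lt hN _) (fun i => val_lt hN _) m (fun i hi => by simp only [h i hi])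
    linarith

/-- if `π(a)` exceeds `π(b)` by more than `ρ ^ m` then `a` is lexicographically larger,
with first difference before `m`. -/
lemma lex_of_pi {N : ℕ} (hN : 2 ≤ N) {ρ : ℝ} (hρ0 : 0 < ρ) (hρ1 : ρ ≤ 1 / (N : ℝ) ^ 2)
    {a b : ℕ → ℕ} (ha : ∀ i, a i < N) (hb : ∀ i, b i < N) {m : ℕ}
    (h : piMap N ρ b + ρ ^ m < piMap N ρ a) :
    ∃ j < m, (∀ i < j, a i = b i) ∧ b j < a j := by
  have hρ := rho_lt_one hN hρ1
  have hR := rho_lt_R hN hρ1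
  have hex : ∃ j, a j ≠ b j := by
    by_contra! hc
    have : a = b := funext hc
    rw [this] at h
    have : 0 < ρ ^ m := by positivity
    linarith
  classical
  have hmin : ∀ i < Nat.find hex, a i = b i := fun i hi => by
    simpa using Nat.find_min hex hi
  refine ⟨Nat.find hex, ?_, hmin, ?_⟩
  · by_contra! hc
    have := pi_agree hN hρ0 hρ ha hb m (fun i hi => hmin i (by omega))
    linarith
  · rcases lt_or_gt_of_ne (Nat.find_spec hex) with hlt | hlt
    · exfalso
      have := pi_gap hN hρ0 hρ hb ha _ (fun i hi => (hmin i hi).symm) hlt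
      have h' : 0 ≤ (R N ρ - ρ) * ρ ^ (Nat.find hex) := mul_nonneg (by linarith) (by positivity)
      have : 0 < ρ ^ m := by positivity
      linarith
    · exact hlt

/-- digitwise form of `lex_of_pi` for the Thue-Morse sequence. -/
lemma gt_of_pi {N : ℕ} (hN : 2 ≤ N) {ρ : ℝ} (hρ0 : 0 < ρ) (hρ1 : ρ ≤ 1 / (N : ℝ) ^ 2)
    {u : ℕ → Bool} (hu : u 0 = true) {a : ℕ → ℕ} (ha : ∀ i, a i < N) {m : ℕ}
    (h : piMap N ρ (fun i => val N (u i)) + ρ ^ m < piMap N ρ a) :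
    a 0 = N - 1 ∧ ∃ j < m, (∀ i < j, a i = val N (u i)) ∧ u j = false ∧ 0 < a j := by
  obtain ⟨j, hjm, h1, h2⟩ := lex_of_pi hN hρ0 hρ1 ha (fun i => val_lt hN (u i)) h
  have hj : u j = false := by
    by_contra hc
    have := ha j
    rw [Bool.not_eq_false] at hc
    simp [val, hc] at h2
    omega
  refine ⟨?_, j, hjm, h1, hj, by omega⟩
  have : j ≠ 0 := by
    rintro rfl
    simp_all
  have := h1 0 (by omega)
  simpa [val, hu] using this

lemma countable_part {N : ℕ} (hN : 2 ≤ N) {ρ : ℝ} (hρ0 : 0 < ρ) (hρ1 : ρ ≤ 1 / (N : ℝ) ^ 2)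
    {u : ℕ → Bool} (hu : IsTM u) {t : ℝ} (ht : piMap N ρ (fun i => val N (u i)) < t) :
    (Eeta N ρ t).Countable := by
  have hρ := rho_lt_one hN hρ1
  refine (countable_EP.image (piMap N ρ)).mono ?_
  rintro x ⟨d, hd, rfl, hlim⟩
  refine ⟨d, ?_, rfl⟩
  obtain ⟨t', ht1, ht2⟩ := exists_between ht
  obtain ⟨m, hm⟩ := exists_pow_lt_of_lt_one (sub_pos.2 ht1) hρ
  have hev := eventually_lt_of_lt_liminf (lt_of_lt_of_le ht2 hlim)
    ⟨0, by
      simp only [eventually_map]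
      exact Eventually.of_forall fun n => le_max_of_le_left (pi_nonneg hN hρ0 hρ _)⟩
  obtain ⟨n0, hn0⟩ := eventually_atTop.1 hev
  have hcase : ∀ n, n0 ≤ n →
      (d n = N - 1 ∧ ∃ j < m, (∀ i < j, d (n + i) = val N (u i)) ∧ u j = false ∧ 0 < d (n + j)) ∨
      (d n = 0 ∧ ∃ j < m, (∀ i < j, N - 1 - d (n + i) = val N (u i)) ∧ u j = false ∧
        0 < N - 1 - d (n + j)) := by
    intro n hn
    rcases lt_max_iff.1 (hn0 n hn) with h | h
    · left
      exact gt_of_pi hN hρ0 hρ1 hu.1 (a := fun i => d (n + i)) (fun i => hd _)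
        (by simp only [Tn] at h; linarith)
    · right
      rw [Tn, pi_reflect hN hρ0 hρ (fun i => hd _)] at h
      have := gt_of_pi hN hρ0 hρ1 hu.1 (a := fun i => N - 1 - d (n + i))
        (fun i => by omega) (m := m) (by linarith)
      refine ⟨?_, this.2⟩
      have h1 := this.1
      have h2 := hd n
      simp only [add_zero] at h1
      omega
  have hval : ∀ i, d (n0 + i) = val N (decide (d (n0 + i) = N - 1)) := by
    intro i
    rcases hcase (n0 + i) (by omega) with h | h
    · simp [val, h.1]
    · simp [val, h.1]
  have hG : Good u m (fun i => decide (d (n0 + i) = N - 1)) := by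
    intro n
    have hv : ∀ i, d (n0 + n + i) = 0 ∨ d (n0 + n + i) = N - 1 := by
      intro i
      rcases hcase (n0 + n + i) (by omega) with h | h
      · exact Or.inr h.1
      · exact Or.inl h.1
    refine (hcase (n0 + n) (by omega)).imp ?_ ?_
    · rintro ⟨-, j, hj, h1, h2, h3⟩
      refine ⟨j, hj, fun i hi => ?_, ?_, h2⟩
      · have := h1 i hi
        simp only [← add_assoc]
        rw [this]
        cases u i <;> simp [val] <;> omega
      · have := hv j
        simp only [← add_assoc]
        simp; omega
    · rintro ⟨-, j, hj, h1, h2, h3⟩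
      refine ⟨j, hj, fun i hi => ?_, ?_, h2⟩
      · have := h1 i hi
        simp only [← add_assoc]
        have := hv i
        cases hui : u i <;> simp [val, hui] at * <;> omega
      · have := hv j
        simp only [← add_assoc]
        simp; omega
  have := (Good.ep hu m _ hG).comp (val N)
  apply EP.of_shift (k := n0)
  convert this using 2
  exact hval _

/-! ### Dimension -/

lemma mem_Eeta {N : ℕ} (hN : 2 ≤ N) {ρ : ℝ} (hρ0 : 0 < ρ) (hρ1 : ρ ≤ 1 / (N : ℝ) ^ 2)
    {u : ℕ → Bool} {t : ℝ} {m : ℕ} (ht : t ≤ piMap N ρ (fun i => val N (u i)) - ρ ^ m)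
    {d : ℕ → Bool} (hd : Wk u m d) : piMap N ρ (fun i => val N (d i)) ∈ Eeta N ρ t := by
  have hρ := rho_lt_one hN hρ1
  refine ⟨_, fun i => val_lt hN _, rfl, ?_⟩
  refine le_liminf_of_le ?_ (Eventually.of_forall fun n => ?_)
  · apply IsBoundedUnder.isCoboundedUnder_ge
    refine ⟨1, ?_⟩
    simp only [eventually_map]
    refine Eventually.of_forall fun n => max_le ?_ ?_
    · exact pi_le_one hN hρ0 hρ fun i => val_lt hN _
    · have := pi_nonneg hN hρ0 hρ (fun i => val N (d (n + i)))
      simp only [Tn]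
      linarith
  · rw [le_max_iff]
    refine (hd n).imp ?_ ?_
    · intro h
      exact ht.trans (h.pi hN hρ0 hρ1)
    · intro h
      refine ht.trans ((h.pi hN hρ0 hρ1).trans ?_)
      rw [Tn, pi_reflect hN hρ0 hρ (fun i => val_lt hN _)]
      simp only [val_not]
      exact le_rfl

/-- binary expansion. -/
noncomputable def bin (e : ℕ → Bool) : ℝ :=
  Real.ofDigits (b := 2) (fun i => if e i then 1 else 0)

lemma bin_surj {y : ℝ} (hy : y ∈ Set.Icc (0 : ℝ) 1) : ∃ e, bin e = y := by
  obtain ⟨x, -, hx⟩ := Real.ofDigits_SurjOn (b := 2) (by norm_num) hy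
  refine ⟨fun i => decide (x i = 1), ?_⟩
  rw [← hx, bin]
  congr 1
  funext i
  generalize x i = z
  revert z
  decide

lemma bin_dist {e e' : ℕ → Bool} {n : ℕ} (h : ∀ i < n, e i = e' i) :
    |bin e - bin e'| ≤ (1 / 2) ^ n := by
  have := Real.abs_ofDigits_sub_ofDigits_le (b := 2) (n := n)
    (x := fun i => if e i then 1 else 0) (y := fun i => if e' i then 1 else 0)
    (fun i hi => by rw [h i hi])
  simpa [bin] using this

lemma dim_part {N : ℕ} (hN : 2 ≤ N) {ρ : ℝ} (hρ0 : 0 < ρ) (hρ1 : ρ ≤ 1 / (N : ℝ) ^ 2)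
    {u : ℕ → Bool} (hu : IsTM u) {t : ℝ} (ht : t < piMap N ρ (fun i => val N (u i))) :
    0 < dimH (Eeta N ρ t) := by
  have hρ := rho_lt_one hN hρ1
  have hR := rho_lt_R hN hρ1
  obtain ⟨k, hk⟩ := exists_pow_lt_of_lt_one (sub_pos.2 ht) hρ
  have hk2 : ρ ^ (2 ^ k) ≤ ρ ^ k :=
    pow_le_pow_of_le_one hρ0.le hρ.le Nat.lt_two_pow_self.le
  set F : (ℕ → Bool) → ℝ := fun e => piMap N ρ (fun i => val N (phi^[k] e i)) with hF
  have hmem : ∀ e, F e ∈ Eeta N ρ t := fun e =>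
    mem_Eeta hN hρ0 hρ1 (by linarith) (wk_iter hu k e)
  -- the Hölder estimate
  set c : ℝ := R N ρ - ρ with hc
  have hc0 : 0 < c := by rw [hc]; linarith
  set q : ℝ := ρ ^ (2 ^ k) with hq
  have hq0 : 0 < q := by positivity
  have hq1 : q < 1 := pow_lt_one₀ hρ0.le hρ (by positivity)
  set r : ℝ := Real.log 2 / (-Real.log q) with hr
  have hlq : Real.log q < 0 := Real.log_neg hq0 hq1
  have hr0 : 0 < r := div_pos (Real.log_pos (by norm_num)) (by linarith)
  have hqr : q ^ r = 1 / 2 := by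
    rw [Real.rpow_def_of_pos hq0, hr]
    rw [show Real.log q * (Real.log 2 / -Real.log q) = - Real.log 2 by
      have := hlq.ne
      field_simp,
      Real.exp_neg, Real.exp_log (by norm_num)]
    norm_num
  have gap : ∀ e e' : ℕ → Bool, ∀ j, (∀ i < j, e i = e' i) → e j = true → e' j = false →
      c * q ^ j ≤ F e - F e' := by
    intro e e' j h1 h2 h3
    have := pi_gap hN hρ0 hρ (a := fun i => val N (phi^[k] e i))
      (b := fun i => val N (phi^[k] e' i)) (fun i => val_lt hN _) (fun i => val_lt hN _)
      (2 ^ k * j) (fun i hi => by simp only [phi_iter_agree k e e' j h1 i hi])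
      (by simp only [phi_iter_mul, h2, h3, val]; simp; omega)
    rwa [pow_mul] at this
  have holder : ∀ e e' : ℕ → Bool, |bin e - bin e'| ≤ (1 / c) ^ r * |F e - F e'| ^ r := by
    intro e e'
    by_cases hee : e = e'
    · rw [hee]; simp; positivity
    have hex : ∃ j, e j ≠ e' j := by
      by_contra! h
      exact hee (funext h)
    classical
    have hmin : ∀ i < Nat.find hex, e i = e' i := fun i hi => by
      simpa using Nat.find_min hex hi
    have hne := Nat.find_spec hex
    set j := Nat.find hex
    have hg : c * q ^ j ≤ |F e - F e'| := by
      cases he : e j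
      · have he' : e' j = true := by cases h : e' j <;> simp_all
        rw [abs_sub_comm]
        exact (gap e' e j (fun i hi => (hmin i hi).symm) he' he).trans (le_abs_self _)
      · have he' : e' j = false := by cases h : e' j <;> simp_all
        exact (gap e e' j hmin he he').trans (le_abs_self _)
    rw [← Real.mul_rpow (by positivity) (abs_nonneg _)]
    calc |bin e - bin e'| ≤ (1 / 2) ^ j := bin_dist hmin
      _ = (q ^ j) ^ r := by
        rw [← hqr, ← Real.rpow_natCast, ← Real.rpow_natCast, ← Real.rpow_mul hq0.le,
          ← Real.rpow_mul hq0.le, mul_comm]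
      _ ≤ (1 / c * |F e - F e'|) ^ r := by
        apply Real.rpow_le_rpow (by positivity) _ hr0.le
        rw [one_div, ← div_eq_inv_mul, le_div_iff₀ hc0, mul_comm]
        exact hg
  set g : ℝ → ℝ := fun x => bin (Function.invFun F x) with hg
  have hgF : ∀ e, F (Function.invFun F (F e)) = F e := fun e =>
    Function.invFun_eq ⟨e, rfl⟩
  have hgF' : ∀ e, g (F e) = bin e := by
    intro e
    have := holder (Function.invFun F (F e)) e
    rw [hgF, sub_self, abs_zero, Real.zero_rpow hr0.ne', mul_zero] at this
    have := abs_nonpos_iff.1 this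
    simp only [hg]
    linarith
  have hH : HolderOnWith (Real.toNNReal ((1 / c) ^ r)) (Real.toNNReal r) g (Set.range F) := by
    rintro _ ⟨e, rfl⟩ _ ⟨e', rfl⟩
    rw [hgF', hgF', Real.coe_toNNReal r hr0.le, edist_dist, edist_dist, Real.dist_eq, Real.dist_eq,
      ENNReal.ofReal_rpow_of_nonneg (abs_nonneg _) hr0.le]
    change _ ≤ ENNReal.ofReal _ * _
    rw [← ENNReal.ofReal_mul (by positivity)]
    exact ENNReal.ofReal_le_ofReal (holder e e')
  have hle := hH.dimH_image_le (Real.toNNReal_pos.2 hr0)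
  have himg : Set.Icc (0 : ℝ) 1 ⊆ Set.image g (Set.range F) := by
    intro y hy
    obtain ⟨e, rfl⟩ := bin_surj hy
    exact ⟨F e, ⟨e, rfl⟩, hgF' e⟩
  have hone : dimH (Set.Icc (0 : ℝ) 1) = 1 := by
    rw [Real.dimH_of_nonempty_interior (by simp [interior_Icc])]
    simp
  have h1 := (dimH_mono himg).trans hle
  rw [hone] at h1
  refine lt_of_lt_of_le ?_ (dimH_mono (Set.range_subset_iff.2 hmem))
  rw [pos_iff_ne_zero]
  intro h0
  rw [h0, ENNReal.zero_div] at h1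
  simp at h1

/-- Lemmas 3.9 and 3.10: `t_η := R Σ_{i≥1} θ_i ρ^{i-1}` is the critical value of `E_η(t)`:
if `t < t_η` then `dim_H E_η(t) > 0`, and if `t > t_η` then `E_η(t)` is countable. -/
theorem Eeta_critical (N : ℕ) (hN : 2 ≤ N) (ρ : ℝ) (hρ0 : 0 < ρ)
    (hρ1 : ρ ≤ 1 / (N : ℝ) ^ 2)
    (th : ℕ → ℕ) (hth1 : th 1 = N - 1)
    (hth2 : ∀ n j : ℕ, 1 ≤ j → j ≤ 2 ^ n → th (2 ^ n + j) = N - 1 - th j)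
    (t : ℝ) :
    (t < R N ρ * ∑' i : ℕ, (th (i + 1) : ℝ) * ρ ^ i → 0 < dimH (Eeta N ρ t)) ∧
    (R N ρ * ∑' i : ℕ, (th (i + 1) : ℝ) * ρ ^ i < t → (Eeta N ρ t).Countable) := by
  -- the Thue-Morse sequence as a binary sequence
  have hN1 : N - 1 ≠ 0 := by omega
  have hval : ∀ i, th (i + 1) = 0 ∨ th (i + 1) = N - 1 := by
    intro i
    induction i using Nat.strong_induction_on with
    | _ i ih =>
    by_cases hi : i = 0
    · subst hi
      exact Or.inr hth1
    · obtain ⟨n, h1, h2⟩ : ∃ n, 2 ^ n ≤ i ∧ i < 2 ^ (n + 1) :=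
        ⟨Nat.log 2 i, Nat.pow_log_le_self 2 hi, Nat.lt_pow_succ_log_self (by norm_num) i⟩
      obtain ⟨j, rfl⟩ := Nat.exists_eq_add_of_le h1
      rw [pow_succ'] at h2
      have hpos : 0 < 2 ^ n := by positivity
      have := hth2 n (j + 1) (by omega) (by omega)
      have := ih j (by omega)
      rw [show 2 ^ n + j + 1 = 2 ^ n + (j + 1) by ring]
      omega
  set u : ℕ → Bool := fun i => decide (th (i + 1) = N - 1) with hu
  have hTM : IsTM u := by
    apply isTM_of
    · simp [hu, hth1]
    · intro n j hj
      have h1 := hth2 n (j + 1) (by omega) (by omega)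
      have h2 := hval j
      simp only [hu]
      rw [show 2 ^ n + j + 1 = 2 ^ n + (j + 1) by ring, h1]
      rcases h2 with h2 | h2
      · simp [h2, Ne.symm hN1]
      · simp [h2, Ne.symm hN1]
  have hpi : R N ρ * ∑' i : ℕ, (th (i + 1) : ℝ) * ρ ^ i = piMap N ρ (fun i => val N (u i)) := by
    simp only [piMap]
    congr 2
    funext i
    congr 2
    rcases hval i with h | h
    · simp [hu, val, h]
    · simp [hu, val, h]
  rw [hpi]
  exact ⟨fun h => dim_part hN hρ0 hρ1 hTM h, fun h => countable_part hN hρ0 hρ1 hTM h⟩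

end HomogeneousCantorDensity
end
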